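/- Let A be a noetherian commutative ring and I ⊆ A an ideal. The full subcategory of compact objects of D_I(A) is skeletally small: there is a set of objects of D_I(A) such that every compact object of D_I(A) is isomorphic to a member of this set. (This is the affine case of the theorem that the compact objects of D_qct(𝔛) form a skeletally small category for a noetherian formal scheme 𝔛, via the equivalence D_qct(Spf A) ≃ D_I(A).) -/

import Mathlib

/-!
STATEMENT 10: Let `A` be a noetherian commutative ring and `I ⊆ A` an ideal. The full
subcategory of compact objects of `D_I(A)` is skeletally small: there is a set (here: a
family indexed by a type in the same universe as `A`) of objects of `D_I(A)` such that
every compact object of `D_I(A)` is isomorphic to a member of this family.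
-/

universe w u

open CategoryTheory Limits

/-- An `A`-module `M` is `I`-torsion if every element of `M` is annihilated by some power
of `I`. -/
def IsTorsionWrt {A : Type u} [CommRing A] (I : Ideal A) (M : Type*) [AddCommGroup M]
    [Module A M] : Prop :=
  ∀ m : M, ∃ k : ℕ, ∀ a ∈ I ^ k, a • m = 0

/-- `D_I(A)`: the class of objects of the unbounded derived category `D(A)` all of whose
homology modules are `I`-torsion. -/
def DTor {A : Type u} [CommRing A] [HasDerivedCategory.{w} (ModuleCat.{u} A)] (I : Ideal A) :
    Set (DerivedCategory (ModuleCat.{u} A)) :=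
  {M | ∀ n : ℤ, IsTorsionWrt I ((DerivedCategory.homologyFunctor (ModuleCat.{u} A) n).obj M)}

/-- The canonical comparison map `⨁ⱼ Hom(E, Y j) →+ Hom(E, ∐ Y)`. -/
noncomputable def coproductComparison {T : Type u} [Category.{w} T] [Preadditive T]
    (E : T) {J : Type u} [DecidableEq J] (Y : J → T) [HasCoproduct Y] :
    DirectSum J (fun j => E ⟶ Y j) →+ (E ⟶ ∐ Y) :=
  DirectSum.toAddMonoid (fun j => AddMonoidHom.mk' (fun f => f ≫ Sigma.ι Y j)
    (fun f g => by simp [Preadditive.add_comp]))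

/-- An object `E` of a full subcategory `S` (whose Hom's and coproducts are computed in the
ambient category `T`) is a compact object of `S` if `Hom(E, −)` commutes with arbitrary
coproducts of families of objects of `S`. -/
def IsCompactObjIn {T : Type u} [Category.{w} T] [Preadditive T] (S : Set T) (E : T) : Prop :=
  ∀ (J : Type u) [DecidableEq J] (Y : J → T) [HasCoproduct Y],
    (∀ j : J, Y j ∈ S) → Function.Bijective (coproductComparison E Y)

section Homology

variable {A : Type u} [CommRing A] {K L : CochainComplex (ModuleCat.{u} A) ℤ}

lemma exists_iCycles_eq {n : ℤ} (z : K.X n) (hz : K.d n (n + 1) z = 0) :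
    ∃ c : K.cycles n, K.iCycles n c = z :=
  ⟨K.cyclesMk (C := ModuleCat.{u} A) z (n + 1) (by simp) hz,
    K.i_cyclesMk (C := ModuleCat.{u} A) z (n + 1) (by simp) hz⟩

lemma iCycles_injective (n : ℤ) : Function.Injective (K.iCycles n) :=
  (ModuleCat.mono_iff_injective _).1 inferInstance

lemma homologyπ_surjective (n : ℤ) : Function.Surjective (K.homologyπ n) :=
  (ModuleCat.epi_iff_surjective _).1 inferInstance

lemma d_iCycles_apply {n : ℤ} (m : ℤ) (c : K.cycles n) : K.d n m (K.iCycles n c) = 0 := by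
  rw [← ConcreteCategory.comp_apply, HomologicalComplex.iCycles_d]
  rfl

lemma homologyπ_eq_zero_iff {m n : ℤ} (h : m + 1 = n) (c : K.cycles n) :
    K.homologyπ n c = 0 ↔ ∃ y : K.X m, K.d m n y = K.iCycles n c := by
  have hm : (ComplexShape.up ℤ).prev n = m := by subst h; simp
  have ex : (ShortComplex.mk _ _ (K.toCycles_comp_homologyπ m n)).Exact :=
    ShortComplex.exact_of_g_is_cokernel _ (K.homologyIsCokernel m n hm)
  constructor
  · intro hc
    obtain ⟨y, hy⟩ := (ShortComplex.moduleCat_exact_iff _).1 ex c hc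
    refine ⟨y, ?_⟩
    dsimp at hy
    rw [← hy, ← ConcreteCategory.comp_apply, HomologicalComplex.toCycles_i]
  · rintro ⟨y, hy⟩
    have : K.toCycles m n y = c := by
      apply iCycles_injective
      rw [← hy, ← ConcreteCategory.comp_apply, HomologicalComplex.toCycles_i]
    rw [← this, ← ConcreteCategory.comp_apply, HomologicalComplex.toCycles_comp_homologyπ]
    rfl

lemma homologyMap_homologyπ_apply (f : K ⟶ L) {n : ℤ} (c : K.cycles n) :
    HomologicalComplex.homologyMap f n (K.homologyπ n c) =
      L.homologyπ n (HomologicalComplex.cyclesMap f n c) := by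
  rw [← ConcreteCategory.comp_apply, HomologicalComplex.homologyπ_naturality]
  rfl

lemma iCycles_cyclesMap_apply (f : K ⟶ L) {n : ℤ} (c : K.cycles n) :
    L.iCycles n (HomologicalComplex.cyclesMap f n c) = f.f n (K.iCycles n c) := by
  rw [← ConcreteCategory.comp_apply, HomologicalComplex.cyclesMap_i]
  rfl

lemma f_d_apply (f : K ⟶ L) (i j : ℤ) (x : K.X i) : f.f j (K.d i j x) = L.d i j (f.f i x) := by
  rw [← ConcreteCategory.comp_apply, ← f.comm]
  rfl

lemma quasiIso_iff_elements (f : K ⟶ L) :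
    QuasiIso f ↔ ∀ n : ℤ,
      (∀ x : K.X (n + 1), K.d (n + 1) (n + 1 + 1) x = 0 →
        (∃ y, L.d n (n + 1) y = f.f (n + 1) x) → ∃ x', K.d n (n + 1) x' = x) ∧
      (∀ y : L.X (n + 1), L.d (n + 1) (n + 1 + 1) y = 0 → ∃ x : K.X (n + 1),
        K.d (n + 1) (n + 1 + 1) x = 0 ∧ ∃ y', f.f (n + 1) x + L.d n (n + 1) y' = y) := by
  have key : QuasiIso f ↔ ∀ n : ℤ, IsIso (HomologicalComplex.homologyMap f (n + 1)) := by
    rw [quasiIso_iff]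
    simp only [quasiIsoAt_iff_isIso_homologyMap]
    refine ⟨fun h n ↦ h _, fun h n ↦ ?_⟩
    obtain ⟨m, rfl⟩ : ∃ m, n = m + 1 := ⟨n - 1, by lia⟩
    exact h m
  rw [key]
  refine forall_congr' fun n ↦ ?_
  rw [ConcreteCategory.isIso_iff_bijective]
  refine and_congr ?_ ?_
  · constructor
    · rintro h x hx ⟨y, hy⟩
      obtain ⟨c, rfl⟩ := exists_iCycles_eq x hx
      refine (homologyπ_eq_zero_iff rfl c).1 (h ?_)
      rw [homologyMap_homologyπ_apply, map_zero, homologyπ_eq_zero_iff rfl]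
      exact ⟨y, by rw [hy, iCycles_cyclesMap_apply]⟩
    · intro h
      refine (injective_iff_map_eq_zero (HomologicalComplex.homologyMap f (n + 1)).hom).2 ?_
      intro a ha
      obtain ⟨c, rfl⟩ := homologyπ_surjective _ a
      have ha : HomologicalComplex.homologyMap f (n + 1) (K.homologyπ (n + 1) c) = 0 := ha
      rw [homologyMap_homologyπ_apply, homologyπ_eq_zero_iff rfl, iCycles_cyclesMap_apply] at ha
      exact (homologyπ_eq_zero_iff rfl c).2 (h _ (d_iCycles_apply _ _) ha)
  · constructor
    · intro h y hy
      obtain ⟨c, rfl⟩ := exists_iCycles_eq y hy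
      obtain ⟨a, ha⟩ := h (L.homologyπ _ c)
      obtain ⟨b, rfl⟩ := homologyπ_surjective _ a
      rw [homologyMap_homologyπ_apply, ← sub_eq_zero, ← map_sub, homologyπ_eq_zero_iff rfl] at ha
      obtain ⟨y', hy'⟩ := ha
      refine ⟨_, d_iCycles_apply _ b, -y', ?_⟩
      rw [map_neg, hy', map_sub, iCycles_cyclesMap_apply]
      abel
    · intro h a
      obtain ⟨c, rfl⟩ := homologyπ_surjective _ a
      obtain ⟨x, hx, y', hy⟩ := h _ (d_iCycles_apply _ c)
      obtain ⟨b, rfl⟩ := exists_iCycles_eq x hx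
      refine ⟨K.homologyπ _ b, ?_⟩
      rw [homologyMap_homologyπ_apply, ← sub_eq_zero, ← map_sub, homologyπ_eq_zero_iff rfl]
      refine ⟨-y', ?_⟩
      rw [map_neg, map_sub, iCycles_cyclesMap_apply, ← hy]
      abel

open DerivedCategory in
/-- The homology of the image of a complex in the derived category. -/
noncomputable def homologyIsoQ [HasDerivedCategory.{w} (ModuleCat.{u} A)]
    (K : CochainComplex (ModuleCat.{u} A) ℤ) (n : ℤ) :
    (homologyFunctor (ModuleCat.{u} A) n).obj (Q.obj K) ≅ K.homology n :=
  (homologyFunctorFactors (ModuleCat.{u} A) n).app K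

open DerivedCategory in
lemma homologyIsoQ_hom_naturality [HasDerivedCategory.{w} (ModuleCat.{u} A)] (f : K ⟶ L) (n : ℤ) :
    (homologyFunctor (ModuleCat.{u} A) n).map (Q.map f) ≫ (homologyIsoQ L n).hom =
      (homologyIsoQ K n).hom ≫ HomologicalComplex.homologyMap f n :=
  homologyFunctorFactors_hom_naturality f n

end Homology

section DirectSumComplex

open DirectSum

variable {A : Type u} [CommRing A] {J : Type u} (X Y : J → CochainComplex (ModuleCat.{u} A) ℤ)

/-- The direct sum of a family of cochain complexes of modules. -/
noncomputable def directSumComplex : CochainComplex (ModuleCat.{u} A) ℤ where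
  X n := ModuleCat.of A (⨁ j, (X j).X n)
  d n m := ModuleCat.ofHom (DirectSum.lmap fun j ↦ ((X j).d n m).hom)
  shape n m h := by
    ext1
    refine LinearMap.ext fun x ↦ DFinsupp.ext fun j ↦ ?_
    simp [DirectSum.lmap_apply, (X j).shape n m h]
  d_comp_d' n m k _ _ := by
    ext1
    refine LinearMap.ext fun x ↦ DFinsupp.ext fun j ↦ ?_
    simp [DirectSum.lmap_apply, ← ConcreteCategory.comp_apply]

namespace directSumComplex

variable {X Y}

lemma d_apply (n m : ℤ) (x : (directSumComplex X).X n) (j : J) :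
    DFunLike.coe (F := ⨁ j, (X j).X m) ((directSumComplex X).d n m x) j =
      (X j).d n m (DFunLike.coe (F := ⨁ j, (X j).X n) x j) :=
  DirectSum.lmap_apply ..

lemma ext_apply {n : ℤ} {x y : (directSumComplex X).X n}
    (h : ∀ j, DFunLike.coe (F := ⨁ j, (X j).X n) x j = DFunLike.coe (F := ⨁ j, (X j).X n) y j) :
    x = y :=
  DFinsupp.ext h

/-- The map of direct sums induced by a family of maps of complexes. -/
noncomputable def map (s : ∀ j, X j ⟶ Y j) : directSumComplex X ⟶ directSumComplex Y where
  f n := ModuleCat.ofHom (DirectSum.lmap fun j ↦ ((s j).f n).hom)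
  comm' n m _ := by
    ext1
    refine LinearMap.ext fun x ↦ ext_apply fun j ↦ ?_
    exact (f_d_apply (s j) n m _).symm

lemma map_apply (s : ∀ j, X j ⟶ Y j) (n : ℤ) (x : (directSumComplex X).X n) (j : J) :
    DFunLike.coe (F := ⨁ j, (Y j).X n) ((map s).f n x) j =
      (s j).f n (DFunLike.coe (F := ⨁ j, (X j).X n) x j) :=
  DirectSum.lmap_apply ..

variable (X) in
/-- The projection from a direct sum of complexes to a summand. -/
noncomputable def π (j : J) : directSumComplex X ⟶ X j where
  f n := ModuleCat.ofHom (DirectSum.component A J (fun j ↦ (X j).X n) j)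
  comm' n m _ := by
    ext1
    refine LinearMap.ext fun x ↦ ?_
    exact (d_apply n m x j).symm

lemma exists_family {n : ℤ} (x : (directSumComplex X).X n) {M : J → Type*} [∀ j, AddCommGroup (M j)]
    (P : ∀ j, (X j).X n → M j → Prop) (h0 : ∀ j, P j 0 0)
    (h : ∀ j, ∃ y, P j (DFunLike.coe (F := ⨁ j, (X j).X n) x j) y) :
    ∃ y : ⨁ j, M j, ∀ j, P j (DFunLike.coe (F := ⨁ j, (X j).X n) x j) (y j) := by
  classical
  choose y hy using h
  let x' : ⨁ j, (X j).X n := x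
  refine ⟨DFinsupp.mk (β := M) (DFinsupp.support x') fun j ↦ y j, fun j ↦ ?_⟩
  by_cases hj : j ∈ DFinsupp.support x'
  · have e : (DFinsupp.mk (β := M) (DFinsupp.support x') fun j ↦ y j) j = y j := by
      simp [DFinsupp.mk_apply, hj]
    exact e ▸ hy j
  · have e : (DFinsupp.mk (β := M) (DFinsupp.support x') fun j ↦ y j) j = 0 := by
      simp only [DFinsupp.mk_apply, dif_neg hj]
    have e' : x' j = 0 := by simpa using hj
    have := h0 j
    rw [← e, ← e'] at this
    exact this

instance quasiIso_map (s : ∀ j, X j ⟶ Y j) [∀ j, QuasiIso (s j)] : QuasiIso (map s) := by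
  have hs := fun j ↦ (quasiIso_iff_elements (s j)).1 inferInstance
  rw [quasiIso_iff_elements]
  intro n
  constructor
  · rintro x hx ⟨y, hy⟩
    obtain ⟨x', hx'⟩ := exists_family x (M := fun j ↦ (X j).X n)
      (fun j a b ↦ (X j).d n (n + 1) b = a) (by simp) fun j ↦ (hs j n).1 _
        (by rw [← d_apply, hx]; rfl) ⟨DFunLike.coe (F := ⨁ j, (Y j).X n) y j, by
          rw [← d_apply, hy, map_apply]⟩
    exact ⟨x', ext_apply fun j ↦ (d_apply ..).trans (hx' j)⟩
  · intro y hy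
    have hy' := fun j ↦ (hs j n).2 (DFunLike.coe (F := ⨁ j, (Y j).X (n + 1)) y j)
        (by rw [← d_apply, hy]; rfl)
    obtain ⟨x', hx'⟩ := exists_family y (M := fun j ↦ (X j).X (n + 1) × (Y j).X n)
      (fun j a b ↦ (X j).d (n + 1) (n + 1 + 1) b.1 = 0 ∧
        (s j).f (n + 1) b.1 + (Y j).d n (n + 1) b.2 = a) (by simp) fun j ↦ by
        obtain ⟨x, h, y', h'⟩ := hy' j
        exact ⟨(x, y'), h, h'⟩
    refine ⟨(DirectSum.lmap (R := A) fun j ↦ LinearMap.fst A ((X j).X (n + 1)) ((Y j).X n)) x',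
      ext_apply fun j ↦ (d_apply ..).trans ?_,
      (DirectSum.lmap (R := A) fun j ↦ LinearMap.snd A ((X j).X (n + 1)) ((Y j).X n)) x',
      ext_apply fun j ↦ ?_⟩
    · exact (hx' j).1
    · refine Eq.trans ?_ (hx' j).2
      exact congrArg₂ (fun a b : (Y j).X (n + 1) ↦ a + b) (map_apply ..) (d_apply ..)

variable [DecidableEq J]

variable (X) in
/-- The inclusion of a summand in a direct sum of complexes. -/
noncomputable def ι (j : J) : X j ⟶ directSumComplex X where
  f n := ModuleCat.ofHom (DirectSum.lof A J (fun j ↦ (X j).X n) j)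
  comm' n m _ := by
    ext1
    refine LinearMap.ext fun x ↦ ?_
    exact DirectSum.lmap_lof (R := A) (fun j ↦ ((X j).d n m).hom) j x

/-- The map from a direct sum of complexes given by a family of maps from the summands. -/
noncomputable def desc {Z : CochainComplex (ModuleCat.{u} A) ℤ} (g : ∀ j, X j ⟶ Z) :
    directSumComplex X ⟶ Z where
  f n := ModuleCat.ofHom (DirectSum.toModule A J _ fun j ↦ ((g j).f n).hom)
  comm' n m _ := by
    ext1
    refine DirectSum.linearMap_ext A fun j ↦ LinearMap.ext fun x ↦ ?_
    have h1 : DirectSum.lmap (R := A) (fun j ↦ ((X j).d n m).hom)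
        (DirectSum.lof A J (fun j ↦ (X j).X n) j x) =
      DirectSum.lof A J (fun j ↦ (X j).X m) j ((X j).d n m x) :=
      DirectSum.lmap_lof (R := A) (fun j ↦ ((X j).d n m).hom) j x
    change Z.d n m (DirectSum.toModule A J (Z.X n) (fun j ↦ ((g j).f n).hom)
        (DirectSum.lof A J (fun j ↦ (X j).X n) j x)) =
      DirectSum.toModule A J (Z.X m) (fun j ↦ ((g j).f m).hom)
        (DirectSum.lmap (R := A) (fun j ↦ ((X j).d n m).hom)
          (DirectSum.lof A J (fun j ↦ (X j).X n) j x))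
    rw [h1, DirectSum.toModule_lof, DirectSum.toModule_lof]
    exact (f_d_apply (g j) n m x).symm

lemma ι_desc {Z : CochainComplex (ModuleCat.{u} A) ℤ} (g : ∀ j, X j ⟶ Z) (j : J) :
    ι X j ≫ desc g = g j := by
  ext n x
  exact DirectSum.toModule_lof A (M := fun j ↦ (X j).X n) (φ := fun j ↦ ((g j).f n).hom) j x

lemma ι_map (s : ∀ j, X j ⟶ Y j) (j : J) : ι X j ≫ map s = s j ≫ ι Y j := by
  ext n x
  exact DirectSum.lmap_lof (R := A) (fun j ↦ ((s j).f n).hom) j x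

lemma ι_π_of_ne {i j : J} (h : i ≠ j) : ι X i ≫ π X j = 0 := by
  ext n x
  exact DFinsupp.single_eq_of_ne (β := fun j ↦ (X j).X n) (b := x) h.symm

variable (X) in
lemma mem_iSup_range_cyclesMap_ι {n : ℤ} (c : (directSumComplex X).cycles (n + 1)) :
    c ∈ ⨆ j, LinearMap.range (HomologicalComplex.cyclesMap (ι X j) (n + 1)).hom := by
  classical
  set x : ⨁ j, (X j).X (n + 1) := (directSumComplex X).iCycles _ c with hx
  have h (j : J) : ∃ b : (X j).cycles (n + 1), (X j).iCycles _ b = x j := by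
    refine exists_iCycles_eq _ ?_
    refine (d_apply _ _ _ _).symm.trans ?_
    rw [hx, d_iCycles_apply]
    rfl
  choose b hb using h
  have : c = ∑ j ∈ DFinsupp.support x,
      HomologicalComplex.cyclesMap (ι X j) (n + 1) (b j) := by
    apply iCycles_injective
    rw [map_sum, ← hx]
    simp only [iCycles_cyclesMap_apply, hb]
    exact (DirectSum.sum_support_of x).symm
  rw [this]
  exact Submodule.sum_mem _ fun j _ ↦
    Submodule.mem_iSup_of_mem j ⟨b j, rfl⟩

open DerivedCategory

variable [HasDerivedCategory.{w} (ModuleCat.{u} A)]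

lemma exists_Q_ι_comp_eq {Z : DerivedCategory (ModuleCat.{u} A)} (f : ∀ j, Q.obj (X j) ⟶ Z) :
    ∃ g : Q.obj (directSumComplex X) ⟶ Z, ∀ j, Q.map (ι X j) ≫ g = f j := by
  let e := Q.objObjPreimageIso Z
  choose X' s hs g hg using fun j ↦ right_fac (f j ≫ e.inv)
  have hs' (j : J) : QuasiIso (s j) := by
    rw [← isIso_Q_map_iff_quasiIso]
    exact hs j
  refine ⟨inv (Q.map (map s)) ≫ Q.map (desc g) ≫ e.hom, fun j ↦ ?_⟩
  have h1 : Q.map (ι X j) ≫ inv (Q.map (map s)) = inv (Q.map (s j)) ≫ Q.map (ι X' j) := by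
    rw [IsIso.eq_inv_comp, ← Category.assoc, IsIso.comp_inv_eq, ← Q.map_comp, ← Q.map_comp, ι_map]
  rw [reassoc_of% h1, ← Q.map_comp_assoc, ι_desc, ← Category.assoc, ← hg, Category.assoc,
    e.inv_hom_id, Category.comp_id]

lemma isIso_of_Q_ι_comp_eq {e : Q.obj (directSumComplex X) ⟶ Q.obj (directSumComplex X)}
    (he : ∀ j, Q.map (ι X j) ≫ e = Q.map (ι X j)) : IsIso e := by
  rw [isIso_iff]
  intro n
  obtain ⟨n, rfl⟩ : ∃ m, n = m + 1 := ⟨n - 1, by lia⟩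
  let α := homologyIsoQ (directSumComplex X) (n + 1)
  have key : α.inv ≫ (homologyFunctor _ (n + 1)).map e ≫ α.hom = 𝟙 _ := by
    rw [← cancel_epi ((directSumComplex X).homologyπ (n + 1)), Category.comp_id]
    ext c
    refine (iSup_le (f := fun j ↦ LinearMap.range
      (HomologicalComplex.cyclesMap (ι X j) (n + 1)).hom) (a := LinearMap.eqLocus
      ((directSumComplex X).homologyπ (n + 1) ≫ α.inv ≫
        (homologyFunctor _ (n + 1)).map e ≫ α.hom).hom
      ((directSumComplex X).homologyπ (n + 1)).hom) ?_) (mem_iSup_range_cyclesMap_ι X c)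
    rintro j _ ⟨b, rfl⟩
    have : HomologicalComplex.homologyMap (ι X j) (n + 1) ≫ α.inv ≫
        (homologyFunctor _ (n + 1)).map e ≫ α.hom =
          HomologicalComplex.homologyMap (ι X j) (n + 1) := by
      rw [← cancel_epi (homologyIsoQ (X j) (n + 1)).hom, ← homologyIsoQ_hom_naturality,
        ← Category.assoc, ← homologyIsoQ_hom_naturality]
      simp only [α, Category.assoc, Iso.hom_inv_id_assoc, ← Functor.map_comp_assoc, he]
    have := (HomologicalComplex.homologyπ_naturality_assoc (ι X j) (n + 1) _).symm.trans <|
      (congrArg ((X j).homologyπ (n + 1) ≫ ·) this).trans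
        (HomologicalComplex.homologyπ_naturality (ι X j) (n + 1))
    exact ConcreteCategory.congr_hom this b
  have : (homologyFunctor _ (n + 1)).map e = α.hom ≫ α.inv := by
    rw [← Iso.inv_comp_eq] at *
    rw [← cancel_mono α.hom, Category.assoc, key]
    simp
  rw [this]
  infer_instance

lemma Q_hom_ext {Z : DerivedCategory (ModuleCat.{u} A)}
    {f g : Q.obj (directSumComplex X) ⟶ Z} (h : ∀ j, Q.map (ι X j) ≫ f = Q.map (ι X j) ≫ g) :
    f = g := by
  rw [← sub_eq_zero]
  obtain ⟨F, u, v, hT⟩ := Pretriangulated.distinguished_cocone_triangle₁ (f - g)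
  have hl (j : J) : ∃ l, Q.map (ι X j) = l ≫ u :=
    Pretriangulated.Triangle.coyoneda_exact₂ _ hT (Q.map (ι X j)) (by
      change Q.map (ι X j) ≫ (f - g) = 0
      rw [Preadditive.comp_sub, h, sub_self])
  choose l hl using hl
  obtain ⟨s, hs⟩ := exists_Q_ι_comp_eq l
  have : IsIso (s ≫ u) := isIso_of_Q_ι_comp_eq fun j ↦ by rw [reassoc_of% hs, ← hl]
  have h0 : u ≫ (f - g) = 0 := Pretriangulated.comp_distTriang_mor_zero₁₂ _ hT
  rw [← cancel_epi (s ≫ u), Category.assoc, h0, Limits.comp_zero, Limits.comp_zero]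

/-- The direct sum of complexes is a coproduct in the derived category. -/
noncomputable def isColimitCofan {J' : Type*} (e : J' ≃ J) :
    IsColimit (Cofan.mk (f := fun i ↦ Q.obj (X (e i))) (Q.obj (directSumComplex X))
      fun i ↦ Q.map (ι X (e i))) :=
  have h (s : Cofan fun i ↦ Q.obj (X (e i))) : ∃ g : Q.obj (directSumComplex X) ⟶ s.pt,
      ∀ i, Q.map (ι X (e i)) ≫ g = s.inj i := by
    obtain ⟨g, hg⟩ := exists_Q_ι_comp_eq (X := X) fun j ↦
      eqToHom (by simp) ≫ s.inj (e.symm j)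
    refine ⟨g, fun i ↦ (hg _).trans ?_⟩
    have (i' : J') (h : i' = i) (h') : eqToHom h' ≫ s.inj i' = s.inj i := by
      subst h
      simp
    exact this _ (by simp) _
  Cofan.IsColimit.mk _ (fun s ↦ (h s).choose) (fun s i ↦ (h s).choose_spec i)
    fun s m hm ↦ Q_hom_ext fun j ↦ by
      obtain ⟨i, rfl⟩ := e.surjective j
      exact (hm i).trans ((h s).choose_spec i).symm

end directSumComplex

end DirectSumComplex

section Torsion

open DirectSum

variable {A : Type u} [CommRing A] (I : Ideal A)

lemma Module.Baer.exists_comp_eq {Q M N : Type*} [AddCommGroup Q] [Module A Q] [AddCommGroup M]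
    [Module A M] [AddCommGroup N] [Module A N] (hQ : Module.Baer A Q) (q : M →ₗ[A] N)
    (f : M →ₗ[A] Q) (h : LinearMap.ker q ≤ LinearMap.ker f) : ∃ g : N →ₗ[A] Q, g ∘ₗ q = f := by
  obtain ⟨g, hg⟩ := hQ.extension_property ((LinearMap.ker q).liftQ q le_rfl)
    (LinearMap.ker_eq_bot.1 (Submodule.ker_liftQ_eq_bot _ _ _ le_rfl))
    ((LinearMap.ker q).liftQ f h)
  exact ⟨g, LinearMap.ext fun x ↦ LinearMap.congr_fun hg ((LinearMap.ker q).mkQ x)⟩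

lemma exists_linearMap_directSum {J M : Type*} [AddCommGroup M] [Module A M] {W : J → Type*}
    [∀ j, AddCommGroup (W j)] [∀ j, Module A (W j)] (φ : ∀ j, M →ₗ[A] W j)
    (h : ∀ x, {j | φ j x ≠ 0}.Finite) : ∃ g : M →ₗ[A] ⨁ j, W j, ∀ x j, g x j = φ j x := by
  classical
  have key (x : M) (j : J) :
      DFinsupp.mk (β := W) (h x).toFinset (fun j ↦ φ j x) j = φ j x := by
    rw [DFinsupp.mk_apply]
    split_ifs with hj
    · rfl
    · exact (by simpa using hj : φ j x = 0).symm
  refine ⟨{ toFun x := DFinsupp.mk (β := W) (h x).toFinset fun j ↦ φ j x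
            map_add' x y := DFinsupp.ext fun j ↦ ?_
            map_smul' a x := DFinsupp.ext fun j ↦ ?_ }, key⟩
  · rw [key]
    exact (map_add _ _ _).trans (congrArg₂ _ (key x j).symm (key y j).symm)
  · rw [key]
    exact (map_smul _ _ _).trans (congrArg (a • ·) (key x j).symm)

lemma Module.Baer.directSum [IsNoetherianRing A] {J : Type*} {W : J → Type*}
    [∀ j, AddCommGroup (W j)] [∀ j, Module A (W j)] (hW : ∀ j, Module.Baer A (W j)) :
    Module.Baer A (⨁ j, W j) := by
  classical
  intro I g
  have hs : ∃ s : Finset J, ∀ x, ∀ j ∉ s, g x j = 0 := by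
    obtain ⟨S, hS⟩ := (inferInstance : Module.Finite A I).fg_top
    refine ⟨S.biUnion fun x ↦ DFinsupp.support (g x), fun x j hj ↦ ?_⟩
    have hx : x ∈ Submodule.span A (S : Set I) := hS ▸ Submodule.mem_top
    refine (Submodule.span_le (p := LinearMap.ker (DirectSum.component A J W j ∘ₗ g))).2 ?_ hx
    intro y hy
    by_contra h
    exact hj (Finset.mem_biUnion.2 ⟨y, hy, DFinsupp.mem_support_iff.2 h⟩)
  obtain ⟨s, hs⟩ := hs
  choose φ hφ using fun j ↦ hW j I (DirectSum.component A J W j ∘ₗ g)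
  obtain ⟨g', hg'⟩ := exists_linearMap_directSum (fun j ↦ if j ∈ s then φ j else 0)
    fun x ↦ s.finite_toSet.subset fun j hj ↦ by
      by_contra h
      exact hj (by rw [if_neg (Finset.mem_coe.not.1 h)]; rfl)
  refine ⟨g', fun x hx ↦ DFinsupp.ext fun j ↦ (hg' x j).trans ?_⟩
  split_ifs with hj
  · exact hφ j x hx
  · exact (hs _ j hj).symm

/-- The submodule of elements annihilated by `J`. -/
def annihilatedBy (J : Ideal A) (M : Type*) [AddCommGroup M] [Module A M] : Submodule A M where
  carrier := {m | ∀ a ∈ J, a • m = 0}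
  add_mem' h h' a ha := by rw [smul_add, h a ha, h' a ha, add_zero]
  zero_mem' a _ := smul_zero a
  smul_mem' b m h a ha := by rw [smul_comm, h a ha, smul_zero]

lemma annihilatedBy_pow_mono (M : Type*) [AddCommGroup M] [Module A M] :
    Monotone fun k ↦ annihilatedBy (I ^ k) M :=
  fun _ _ h _ hm a ha ↦ hm a (Ideal.pow_le_pow_right h ha)

/-- The submodule of elements annihilated by some power of `I`. -/
def powerTorsion (M : Type*) [AddCommGroup M] [Module A M] : Submodule A M :=
  ⨆ k, annihilatedBy (I ^ k) M

variable {I}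

lemma mem_powerTorsion {M : Type*} [AddCommGroup M] [Module A M] {m : M} :
    m ∈ powerTorsion I M ↔ ∃ k : ℕ, ∀ a ∈ I ^ k, a • m = 0 :=
  Submodule.mem_iSup_of_directed _ (annihilatedBy_pow_mono I M).directed_le

lemma isTorsionWrt_powerTorsion (M : Type*) [AddCommGroup M] [Module A M] :
    IsTorsionWrt I (powerTorsion I M) := fun m ↦ by
  obtain ⟨k, hk⟩ := mem_powerTorsion.1 m.2
  exact ⟨k, fun a ha ↦ Subtype.ext (hk a ha)⟩

lemma IsTorsionWrt.exists_pow_smul_eq_zero {M N : Type*} [AddCommGroup M] [Module A M]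
    [AddCommGroup N] [Module A N] [IsNoetherian A M] (hN : IsTorsionWrt I N) (f : M →ₗ[A] N) :
    ∃ k : ℕ, ∀ a ∈ I ^ k, ∀ x, a • f x = 0 := by
  obtain ⟨n, hn⟩ := monotone_stabilizes_iff_noetherian.2 ‹IsNoetherian A M›
    ⟨fun k ↦ (annihilatedBy (I ^ k) N).comap f,
      fun _ _ h ↦ Submodule.comap_mono (annihilatedBy_pow_mono I N h)⟩
  refine ⟨n, fun a ha x ↦ ?_⟩
  obtain ⟨k, hk⟩ := hN (f x)
  have h1 : x ∈ (annihilatedBy (I ^ (max n k)) N).comap f :=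
    annihilatedBy_pow_mono I N (le_max_right n k) hk
  exact (hn (max n k) (le_max_left n k)).ge h1 a ha

lemma Module.Baer.powerTorsion [IsNoetherianRing A] {E : Type*} [AddCommGroup E] [Module A E]
    (hE : Module.Baer A E) : Module.Baer A (powerTorsion I E) := by
  intro J g
  obtain ⟨k, hk⟩ := (isTorsionWrt_powerTorsion (I := I) E).exists_pow_smul_eq_zero g
  obtain ⟨c, hc⟩ := Ideal.exists_pow_inf_eq_pow_smul I J
  have h0 : ∀ x ∈ I ^ k • J, ∃ hx : x ∈ J, g ⟨x, hx⟩ = 0 := by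
    intro x hx
    refine Submodule.smul_induction_on hx (fun a ha y hy ↦ ?_) ?_
    · exact ⟨J.mul_mem_left a hy, (map_smul g a ⟨y, hy⟩).trans (hk a ha _)⟩
    · rintro x y ⟨hx, hx'⟩ ⟨hy, hy'⟩
      exact ⟨J.add_mem hx hy, (map_add g ⟨x, hx⟩ ⟨y, hy⟩).trans (by rw [hx', hy', add_zero])⟩
  obtain ⟨h, hh⟩ := hE.exists_comp_eq ((I ^ (c + k)).mkQ ∘ₗ J.subtype)
    ((_root_.powerTorsion I E).subtype ∘ₗ g) fun x hx ↦ by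
      have hx' : (x : A) ∈ I ^ (c + k) := (Submodule.Quotient.mk_eq_zero _).1 hx
      have : (x : A) ∈ I ^ (c + k) • (⊤ : Ideal A) ⊓ J := ⟨by simpa using hx', x.2⟩
      rw [hc _ (by lia), Nat.add_sub_cancel_left] at this
      obtain ⟨_, h⟩ := h0 _ (Submodule.smul_mono le_rfl inf_le_right this)
      exact congrArg Subtype.val h
  refine ⟨(h ∘ₗ (I ^ (c + k)).mkQ).codRestrict _ fun r ↦ mem_powerTorsion.2 ⟨c + k, fun a ha ↦ ?_⟩,
    fun x hx ↦ Subtype.ext (LinearMap.congr_fun hh ⟨x, hx⟩)⟩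
  rw [← map_smul]
  refine (congrArg h ?_).trans (map_zero h)
  exact (Submodule.Quotient.mk_eq_zero _).2 (Ideal.mul_mem_right r _ ha)

lemma exists_baer_embedding (N : Type u) [AddCommGroup N] [Module A N] :
    ∃ (E : ModuleCat.{u} A) (i : N →ₗ[A] E), Module.Baer A E ∧ Function.Injective i :=
  let E := Injective.under (ModuleCat.of A N)
  have : Injective (ModuleCat.of A E) := inferInstanceAs (Injective E)
  ⟨E, (Injective.ι (ModuleCat.of A N)).hom,
    Module.Baer.of_injective (Module.injective_module_of_injective_object _ _),
    (ModuleCat.mono_iff_injective _).1 inferInstance⟩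

lemma IsTorsionWrt.exists_baer_embedding [IsNoetherianRing A] {N : Type u} [AddCommGroup N]
    [Module A N] (hN : IsTorsionWrt I N) :
    ∃ (E : ModuleCat.{u} A) (i : N →ₗ[A] E), IsTorsionWrt I E ∧ Module.Baer A E ∧
      Function.Injective i := by
  obtain ⟨E, i, hE, hi⟩ := _root_.exists_baer_embedding (A := A) N
  refine ⟨ModuleCat.of A (powerTorsion I E), i.codRestrict _ fun x ↦ ?_,
    isTorsionWrt_powerTorsion E, hE.powerTorsion, fun x y h ↦ hi (congrArg Subtype.val h)⟩
  obtain ⟨k, hk⟩ := hN x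
  exact mem_powerTorsion.2 ⟨k, fun a ha ↦ by rw [← map_smul, hk a ha, map_zero]⟩

lemma IsTorsionWrt.of_surjective {N P : Type*} [AddCommGroup N] [Module A N] [AddCommGroup P]
    [Module A P] (hN : IsTorsionWrt I N) {f : N →ₗ[A] P} (hf : Function.Surjective f) :
    IsTorsionWrt I P := fun m ↦ by
  obtain ⟨x, rfl⟩ := hf m
  obtain ⟨k, hk⟩ := hN x
  exact ⟨k, fun a ha ↦ by rw [← map_smul, hk a ha, map_zero]⟩

lemma IsTorsionWrt.of_injective {N P : Type*} [AddCommGroup N] [Module A N] [AddCommGroup P]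
    [Module A P] (hP : IsTorsionWrt I P) {f : N →ₗ[A] P} (hf : Function.Injective f) :
    IsTorsionWrt I N := fun x ↦ by
  obtain ⟨k, hk⟩ := hP (f x)
  exact ⟨k, fun a ha ↦ hf (by rw [map_smul, hk a ha, map_zero])⟩

/-- A torsion module that is not noetherian has a map to an infinite direct sum of torsion modules
with injective total sum, all of whose components are nonzero. -/
lemma IsTorsionWrt.exists_map_directSum [IsNoetherianRing A] {N : Type u} [AddCommGroup N]
    [Module A N] (hN : IsTorsionWrt I N) (hfg : ¬ IsNoetherian A N) :
    ∃ (W : ULift.{u} ℕ → ModuleCat.{u} A) (g : N →ₗ[A] ⨁ j, W j),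
      (∀ j, IsTorsionWrt I (W j)) ∧ Module.Baer A (⨁ j, W j) ∧ ∀ j, ∃ x, g x j ≠ 0 := by
  rw [← monotone_stabilizes_iff_noetherian] at hfg
  push Not at hfg
  obtain ⟨f, hf⟩ := hfg
  choose W i hW hW' hi using
    fun j : ULift.{u} ℕ ↦ (hN.of_surjective (f j.down).mkQ_surjective).exists_baer_embedding
  have hmem (x : N) : x ∈ ⨆ k, f k ↔ ∃ k, x ∈ f k :=
    Submodule.mem_iSup_of_directed _ f.monotone.directed_le
  have hB : Module.Baer A (⨁ j, W j) := Module.Baer.directSum hW'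
  obtain ⟨g, hg⟩ := exists_linearMap_directSum
    (fun j ↦ i j ∘ₗ (f j.down).mkQ ∘ₗ (⨆ k, f k).subtype) fun x ↦ by
      obtain ⟨k, hk⟩ := (hmem x).1 x.2
      refine ((Set.finite_Iio k).preimage (ULift.down_injective.injOn)).subset fun j hj ↦ ?_
      by_contra h
      refine hj ?_
      have : (x : N) ∈ f j.down := f.monotone (not_lt.1 h) hk
      change i j ((f j.down).mkQ x) = 0
      rw [Submodule.mkQ_apply, (Submodule.Quotient.mk_eq_zero _).2 this, map_zero]
  obtain ⟨g', hg'⟩ := hB.extension_property (⨆ k, f k).subtype Subtype.val_injective g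
  refine ⟨W, g', hW, hB, fun j ↦ ?_⟩
  obtain ⟨m, hm, hne⟩ := hf j.down
  obtain ⟨x, hx, hx'⟩ := SetLike.exists_of_lt (lt_of_le_of_ne (f.monotone hm) hne)
  refine ⟨x, fun h ↦ hx' ?_⟩
  have h1 : g' x = g ⟨x, (hmem x).2 ⟨m, hx⟩⟩ := LinearMap.congr_fun hg' ⟨x, (hmem x).2 ⟨m, hx⟩⟩
  rw [h1, hg] at h
  exact (Submodule.Quotient.mk_eq_zero _).1 (hi j (h.trans (map_zero _).symm))

end Torsion

section Compact

open DirectSum DerivedCategory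

variable {A : Type u} [CommRing A] {I : Ideal A}

/-- A map from the homology of a complex to an injective direct sum of modules is induced by a
map from the complex to a direct sum of complexes concentrated in one degree. -/
lemma exists_hom_directSumComplex_single (K : CochainComplex (ModuleCat.{u} A) ℤ) (n : ℤ)
    {J : Type u} {W : J → ModuleCat.{u} A} (hW : Module.Baer A (⨁ j, W j))
    (g : K.homology n →ₗ[A] ⨁ j, W j) :
    ∃ f : K ⟶ directSumComplex fun j ↦ (HomologicalComplex.single _ (.up ℤ) n).obj (W j),
      ∀ j, HomologicalComplex.homologyMap (f ≫ directSumComplex.π _ j) n = 0 →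
        ∀ x, g x j = 0 := by
  obtain ⟨h, hh⟩ := hW.extension_property (K.iCycles n).hom (iCycles_injective n)
    (g ∘ₗ (K.homologyπ n).hom)
  replace hh (c : K.cycles n) : h (K.iCycles n c) = g (K.homologyπ n c) :=
    LinearMap.congr_fun hh c
  let S (j : J) := (HomologicalComplex.single _ (.up ℤ) n).obj (W j)
  let σ (j : J) : W j ≅ (S j).X n := (HomologicalComplex.singleObjXSelf (.up ℤ) n (W j)).symm
  let f₁ : K ⟶ (HomologicalComplex.single _ (.up ℤ) n).obj (ModuleCat.of A (⨁ j, W j)) :=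
    HomologicalComplex.mkHomToSingle (ModuleCat.ofHom h) fun m hm ↦ by
      ext1
      refine LinearMap.ext fun y ↦ ?_
      obtain ⟨c, hc⟩ := exists_iCycles_eq (K.d m n y) (by
        rw [← ConcreteCategory.comp_apply, K.d_comp_d]
        rfl)
      change h (K.d m n y) = 0
      rw [← hc, hh, (homologyπ_eq_zero_iff hm c).2 ⟨y, hc.symm⟩, map_zero]
  let f₂ : (HomologicalComplex.single _ (.up ℤ) n).obj (ModuleCat.of A (⨁ j, W j)) ⟶
      directSumComplex S :=
    HomologicalComplex.mkHomFromSingle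
      (ModuleCat.ofHom (DirectSum.lmap fun j ↦ (σ j).hom.hom)) fun m hm ↦ by
        ext1
        refine LinearMap.ext fun x ↦ directSumComplex.ext_apply fun j ↦ ?_
        refine (directSumComplex.d_apply ..).trans ?_
        rw [HomologicalComplex.single_obj_d]
        rfl
  have hf : (f₁ ≫ f₂).f n = ModuleCat.ofHom h ≫
      ModuleCat.ofHom (DirectSum.lmap fun j ↦ (σ j).hom.hom) := by
    rw [HomologicalComplex.comp_f, HomologicalComplex.mkHomToSingle_f, Category.assoc]
    exact congrArg (ModuleCat.ofHom h ≫ ·) ((congrArg (_ ≫ ·)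
      (HomologicalComplex.mkHomFromSingle_f ..)).trans (Iso.inv_hom_id_assoc ..))
  have hf' (j : J) (x : K.X n) : ((f₁ ≫ f₂) ≫ directSumComplex.π S j).f n x =
      (σ j).hom (h x j) := by
    refine (congrArg (fun z ↦ DirectSum.component A J (fun j ↦ (S j).X n) j z)
      (ConcreteCategory.congr_hom hf x)).trans ?_
    exact DirectSum.lmap_apply (fun j ↦ (σ j).hom.hom) (h x) j
  refine ⟨f₁ ≫ f₂, fun j hj x ↦ ?_⟩
  obtain ⟨c, rfl⟩ := homologyπ_surjective n x
  have h0 := ConcreteCategory.congr_hom hj (K.homologyπ n c)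
  rw [homologyMap_homologyπ_apply] at h0
  obtain ⟨y, hy⟩ := (homologyπ_eq_zero_iff (m := n - 1) (by lia) _).1 h0
  rw [iCycles_cyclesMap_apply, hf', HomologicalComplex.single_obj_d] at hy
  rw [← hh]
  exact (σ j).toLinearEquiv.injective (hy.symm.trans (map_zero (σ j).toLinearEquiv).symm)

variable [HasDerivedCategory.{w} (ModuleCat.{u} A)]

lemma Q_obj_mem_DTor_iff {K : CochainComplex (ModuleCat.{u} A) ℤ} :
    Q.obj K ∈ DTor I ↔ ∀ n, IsTorsionWrt I (K.homology n) :=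
  forall_congr' fun n ↦
    ⟨fun h ↦ h.of_surjective (homologyIsoQ K n).toLinearEquiv.surjective,
      fun h ↦ h.of_injective (homologyIsoQ K n).toLinearEquiv.injective⟩

lemma Q_obj_single_mem_DTor {W : ModuleCat.{u} A} (hW : IsTorsionWrt I W) (n : ℤ) :
    Q.obj ((HomologicalComplex.single _ (ComplexShape.up ℤ) n).obj W) ∈ DTor I := by
  rw [Q_obj_mem_DTor_iff]
  intro m
  have hX : IsTorsionWrt I
      (((HomologicalComplex.single (ModuleCat A) (ComplexShape.up ℤ) n).obj W).X m) := by
    by_cases h : m = n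
    · subst h
      exact hW.of_injective
        (HomologicalComplex.singleObjXSelf (.up ℤ) m W).toLinearEquiv.injective
    · have := ModuleCat.subsingleton_of_isZero
        (HomologicalComplex.isZero_single_obj_X (.up ℤ) n W m h)
      exact fun x ↦ ⟨0, fun a _ ↦ Subsingleton.elim _ _⟩
  set K := (HomologicalComplex.single (ModuleCat A) (ComplexShape.up ℤ) n).obj W
  exact (hX.of_injective (f := (K.iCycles m).hom) (iCycles_injective m)).of_surjective
    (f := (K.homologyπ m).hom) (homologyπ_surjective m)

lemma IsCompactObjIn.comp_Q_map_π_eq_zero {M : DerivedCategory (ModuleCat.{u} A)}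
    (hM : IsCompactObjIn (DTor I) M) {J : Type u}
    {X : J → CochainComplex (ModuleCat.{u} A) ℤ} (hX : ∀ j, Q.obj (X j) ∈ DTor I)
    (φ : M ⟶ Q.obj (directSumComplex X)) :
    ∃ s : Finset J, ∀ j ∉ s, φ ≫ Q.map (directSumComplex.π X j) = 0 := by
  classical
  let e : ULift.{u + 1} J ≃ J := Equiv.ulift
  let Y (i : ULift.{u + 1} J) : DerivedCategory (ModuleCat.{u} A) := Q.obj (X (e i))
  have c := directSumComplex.isColimitCofan (X := X) e
  have : HasCoproduct Y := ⟨⟨_, c⟩⟩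
  let θ : ∐ Y ≅ Q.obj (directSumComplex X) :=
    (coproductIsCoproduct Y).coconePointUniqueUpToIso c
  have hθ (i) : Sigma.ι Y i ≫ θ.hom = Q.map (directSumComplex.ι X (e i)) :=
    (coproductIsCoproduct Y).comp_coconePointUniqueUpToIso_hom c ⟨i⟩
  obtain ⟨x, hx⟩ := (hM _ Y fun i ↦ hX (e i)).2 (φ ≫ θ.inv)
  have key : ∃ s : Finset J, ∀ j ∉ s,
      coproductComparison M Y x ≫ θ.hom ≫ Q.map (directSumComplex.π X j) = 0 := by
    clear hx
    induction x using DirectSum.induction_on with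
    | zero => exact ⟨∅, fun j _ ↦ by rw [map_zero, zero_comp]⟩
    | of i f =>
      refine ⟨{e i}, fun j hj ↦ ?_⟩
      have h : coproductComparison M Y (DirectSum.of _ i f) = f ≫ Sigma.ι Y i :=
        DirectSum.toAddMonoid_of ..
      rw [h, Category.assoc, reassoc_of% hθ, ← Q.map_comp,
        directSumComplex.ι_π_of_ne (by simpa [eq_comm] using hj), Q.map_zero, comp_zero]
    | add x y hx hy =>
      obtain ⟨s, hs⟩ := hx
      obtain ⟨t, ht⟩ := hy
      refine ⟨s ∪ t, fun j hj ↦ ?_⟩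
      rw [Finset.mem_union, not_or] at hj
      rw [map_add, Preadditive.add_comp, hs j hj.1, ht j hj.2, add_zero]
  obtain ⟨s, hs⟩ := key
  exact ⟨s, fun j hj ↦ by simpa [hx] using hs j hj⟩

lemma IsCompactObjIn.isNoetherian_homology [IsNoetherianRing A]
    {K : CochainComplex (ModuleCat.{u} A) ℤ} {M : DerivedCategory (ModuleCat.{u} A)}
    (e : M ≅ Q.obj K) (hM : M ∈ DTor I) (hc : IsCompactObjIn (DTor I) M) (n : ℤ) :
    IsNoetherian A (K.homology n) := by
  by_contra hn
  have hK : IsTorsionWrt I (K.homology n) := (hM n).of_surjective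
    ((homologyFunctor _ n).mapIso e ≪≫ homologyIsoQ K n).toLinearEquiv.surjective
  obtain ⟨W, g, hW, hB, hg⟩ := hK.exists_map_directSum hn
  obtain ⟨f, hf⟩ := exists_hom_directSumComplex_single K n hB g
  obtain ⟨s, hs⟩ := hc.comp_Q_map_π_eq_zero (fun j ↦ Q_obj_single_mem_DTor (hW j) n)
    (e.hom ≫ Q.map f)
  obtain ⟨j, hj⟩ := Infinite.exists_notMem_finset s
  obtain ⟨x, hx⟩ := hg j
  refine hx (hf j ?_ x)
  have h0 := hs j hj
  rw [Category.assoc, ← Q.map_comp, Preadditive.IsIso.comp_left_eq_zero] at h0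
  rw [← cancel_epi (homologyIsoQ K n).hom, ← homologyIsoQ_hom_naturality, h0,
    Functor.map_zero, zero_comp, comp_zero]

end Compact

section SmallModel

/-- Formal expressions in countably many generators in each degree, built with the operations of a
complex of `A`-modules and with a choice of preimages under its differentials. -/
inductive ComplexTerm (A : Type u) : Type u
  | gen (k : ℕ) : ComplexTerm A
  | add (s t : ComplexTerm A) : ComplexTerm A
  | smul (a : A) (t : ComplexTerm A) : ComplexTerm A
  | d (i : ℤ) (t : ComplexTerm A) : ComplexTerm A
  | lift (i : ℤ) (t : ComplexTerm A) : ComplexTerm A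

namespace ComplexTerm

variable {A : Type u} [CommRing A]

variable (A) in
/-- The endomorphism of the free module on formal expressions which formally applies the
differential of degree `i`. -/
noncomputable def freeD (i : ℤ) : (ComplexTerm A →₀ A) →ₗ[A] (ComplexTerm A →₀ A) :=
  Finsupp.lmapDomain A A (d i)

variable (A) in
/-- Families of submodules of the free module on formal expressions for which the formal
differentials induce differentials on the quotients. -/
structure Relations : Type u where
  rel : ℤ → Submodule A (ComplexTerm A →₀ A)
  le_comap (n m : ℤ) : rel n ≤ (rel m).comap (freeD A n)
  shape (n m : ℤ) (h : n + 1 ≠ m) (x : ComplexTerm A →₀ A) : freeD A n x ∈ rel m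
  freeD_freeD_mem (n m k : ℤ) (x : ComplexTerm A →₀ A) : freeD A m (freeD A n x) ∈ rel k

/-- The complex presented by a family of relations. -/
noncomputable def Relations.complex (R : Relations A) : CochainComplex (ModuleCat.{u} A) ℤ where
  X n := ModuleCat.of A ((ComplexTerm A →₀ A) ⧸ R.rel n)
  d n m := ModuleCat.ofHom ((R.rel n).mapQ (R.rel m) (freeD A n) (R.le_comap n m))
  shape n m h := by
    ext1
    refine Submodule.linearMap_qext _ (LinearMap.ext fun x ↦ ?_)
    exact (Submodule.Quotient.mk_eq_zero _).2 (R.shape n m h x)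
  d_comp_d' n m k _ _ := by
    ext1
    refine Submodule.linearMap_qext _ (LinearMap.ext fun x ↦ ?_)
    exact (Submodule.Quotient.mk_eq_zero _).2 (R.freeD_freeD_mem n m k x)

variable {K : CochainComplex (ModuleCat.{u} A) ℤ} (z : ∀ n, ℕ → K.X n)
  (σ : ∀ n i, K.X i → K.X n)

/-- The value in degree `n` of a formal expression, for given values of the generators and given
choices of preimages. -/
noncomputable def eval : ComplexTerm A → ∀ n, K.X n
  | gen k, n => z n k
  | add s t, n => eval s n + eval t n
  | smul a t, n => a • eval t n
  | d i t, n => K.d i n (eval t i)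
  | lift i t, n => σ n i (eval t i)

/-- The linear extension of `ComplexTerm.eval`. -/
noncomputable def linearEval (n : ℤ) : (ComplexTerm A →₀ A) →ₗ[A] K.X n :=
  Finsupp.linearCombination A fun t ↦ eval z σ t n

lemma linearEval_single (n : ℤ) (t : ComplexTerm A) :
    linearEval z σ n (Finsupp.single t 1) = eval z σ t n := by
  rw [linearEval, Finsupp.linearCombination_single, one_smul]

lemma linearEval_freeD (n m : ℤ) (x : ComplexTerm A →₀ A) :
    linearEval z σ m (freeD A n x) = K.d n m (linearEval z σ n x) := by
  refine LinearMap.congr_fun (f := linearEval z σ m ∘ₗ freeD A n)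
    (g := (K.d n m).hom ∘ₗ linearEval z σ n) (Finsupp.lhom_ext' fun t ↦ LinearMap.ext_ring ?_) x
  change linearEval z σ m (Finsupp.mapDomain (d n) (Finsupp.single t 1)) =
    K.d n m (linearEval z σ n (Finsupp.single t 1))
  rw [Finsupp.mapDomain_single, linearEval_single, linearEval_single]
  rfl

lemma exists_eval_eq (n : ℤ) (x : ComplexTerm A →₀ A) : ∃ t, eval z σ t n = linearEval z σ n x := by
  induction x using Finsupp.induction_linear with
  | zero => exact ⟨smul 0 (gen 0), (zero_smul _ _).trans (map_zero _).symm⟩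
  | add x y hx hy =>
    obtain ⟨s, hs⟩ := hx
    obtain ⟨t, ht⟩ := hy
    exact ⟨add s t, by rw [eval, hs, ht, map_add]⟩
  | single t a => exact ⟨smul a t, by rw [eval, linearEval, Finsupp.linearCombination_single]⟩

/-- The relations satisfied by the values of formal expressions in a complex. -/
noncomputable def relations : Relations A where
  rel n := LinearMap.ker (linearEval z σ n)
  le_comap n m x hx := by
    rw [Submodule.mem_comap, LinearMap.mem_ker, linearEval_freeD, LinearMap.mem_ker.1 hx, map_zero]
  shape n m h x := by
    rw [LinearMap.mem_ker, linearEval_freeD, K.shape n m h]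
    rfl
  freeD_freeD_mem n m k x := by
    rw [LinearMap.mem_ker, linearEval_freeD, linearEval_freeD, ← ConcreteCategory.comp_apply,
      K.d_comp_d]
    rfl

/-- The subcomplex of values of formal expressions. -/
noncomputable def relationsHom : (relations z σ).complex ⟶ K where
  f n := ModuleCat.ofHom ((LinearMap.ker (linearEval z σ n)).liftQ (linearEval z σ n) le_rfl)
  comm' n m _ := by
    ext1
    exact Submodule.linearMap_qext _ (LinearMap.ext fun x ↦ (linearEval_freeD z σ n m x).symm)

lemma relationsHom_f_injective (n : ℤ) : Function.Injective ((relationsHom z σ).f n) :=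
  LinearMap.ker_eq_bot.1 (Submodule.ker_liftQ_eq_bot _ _ _ le_rfl)

lemma exists_relationsHom_f_eq (n : ℤ) (t : ComplexTerm A) :
    ∃ x, (relationsHom z σ).f n x = eval z σ t n :=
  ⟨Submodule.Quotient.mk (Finsupp.single t 1), linearEval_single z σ n t⟩

variable {z σ}

lemma quasiIso_relationsHom
    (hσ : ∀ n (x : K.X (n + 1)), (∃ y, K.d n (n + 1) y = x) → K.d n (n + 1) (σ n (n + 1) x) = x)
    (hz : ∀ n (y : K.X n), K.d n (n + 1) y = 0 →
      ∃ x ∈ Submodule.span A (Set.range (z n)), K.d n (n + 1) x = 0 ∧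
        ∃ m, ∃ y' : K.X m, x + K.d m n y' = y) :
    QuasiIso (relationsHom z σ) := by
  rw [quasiIso_iff_elements]
  intro n
  constructor
  · rintro x hx hy
    obtain ⟨l, rfl⟩ := Submodule.mkQ_surjective _ x
    obtain ⟨t, ht⟩ := exists_eval_eq z σ (n + 1) l
    obtain ⟨x', hx'⟩ := exists_relationsHom_f_eq z σ n (lift (n + 1) t)
    refine ⟨x', relationsHom_f_injective z σ _ ?_⟩
    rw [f_d_apply, hx']
    exact (congrArg (fun v ↦ K.d n (n + 1) (σ n (n + 1) v)) ht).trans (hσ n _ hy)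
  · intro y hy
    obtain ⟨x, hx, hx', m, y', h⟩ := hz _ y hy
    have hle : Submodule.span A (Set.range (z (n + 1))) ≤
        LinearMap.range ((relationsHom z σ).f (n + 1)).hom := by
      rw [Submodule.span_le]
      rintro _ ⟨k, rfl⟩
      exact exists_relationsHom_f_eq z σ (n + 1) (gen k)
    obtain ⟨x, rfl⟩ := hle hx
    refine ⟨x, relationsHom_f_injective z σ _ ?_, ?_⟩
    · rw [f_d_apply, map_zero]
      exact hx'
    · by_cases hm : m = n
      · subst hm
        exact ⟨y', h⟩
      · refine ⟨0, ?_⟩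
        rw [K.shape m (n + 1) (fun h ↦ hm (by simpa using h))] at h
        rw [map_zero]
        exact h

end ComplexTerm

open ComplexTerm in
/-- A complex with noetherian homology is quasi-isomorphic to one presented by relations between
formal expressions. -/
lemma exists_quasiIso_relations {A : Type u} [CommRing A] (K : CochainComplex (ModuleCat.{u} A) ℤ)
    (hK : ∀ n, IsNoetherian A (K.homology n)) :
    ∃ (R : Relations A) (f : R.complex ⟶ K), QuasiIso f := by
  classical
  have hz (n : ℤ) : ∃ z : ℕ → K.cycles n,
      Submodule.span A (Set.range fun k ↦ K.homologyπ n (z k)) = ⊤ := by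
    obtain ⟨S, hS⟩ := (IsNoetherian.noetherian (⊤ : Submodule A (K.homology n)))
    obtain ⟨s, hs⟩ := ((Finset.countable_toSet S).insert 0).exists_eq_range (Set.insert_nonempty ..)
    choose z hz using fun k ↦ homologyπ_surjective n (s k)
    refine ⟨z, ?_⟩
    simp only [hz]
    rw [← hs, eq_top_iff, ← hS]
    exact Submodule.span_mono (Set.subset_insert ..)
  choose z hz using hz
  let σ (n i : ℤ) (x : K.X i) : K.X n := if h : ∃ y, K.d n i y = x then h.choose else 0
  refine ⟨relations (fun n k ↦ K.iCycles n (z n k)) σ, relationsHom _ _,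
    quasiIso_relationsHom (fun n x h ↦ ?_) fun n y hy ↦ ?_⟩
  · rw [show σ n (n + 1) x = h.choose from dif_pos h]
    exact h.choose_spec
  · obtain ⟨c, rfl⟩ := exists_iCycles_eq y hy
    have hc : K.homologyπ n c ∈
        (Submodule.span A (Set.range (z n))).map (K.homologyπ n).hom := by
      rw [Submodule.map_span, ← Set.range_comp]
      exact (hz n).ge Submodule.mem_top
    obtain ⟨b, hb, hbc⟩ := hc
    have h0 : K.homologyπ n (c - b) = 0 := by
      rw [map_sub, sub_eq_zero]
      exact hbc.symm
    obtain ⟨y', hy'⟩ := (homologyπ_eq_zero_iff (m := n - 1) (by lia) _).1 h0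
    refine ⟨K.iCycles n b, ?_, d_iCycles_apply _ b, n - 1, y', ?_⟩
    · have := Submodule.mem_map_of_mem (f := (K.iCycles n).hom) hb
      rw [Submodule.map_span, ← Set.range_comp] at this
      exact this
    · rw [hy', map_sub, add_sub_cancel]

end SmallModel

theorem compact_objects_of_DTor_skeletally_small
    {A : Type u} [CommRing A] [IsNoetherianRing A]
    [HasDerivedCategory.{w} (ModuleCat.{u} A)] (I : Ideal A) :
    ∃ (ι : Type u) (F : ι → DerivedCategory (ModuleCat.{u} A)),
      ∀ M ∈ DTor I, IsCompactObjIn (DTor I) M → ∃ i : ι, Nonempty (M ≅ F i) := by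
  refine ⟨ComplexTerm.Relations A, fun R ↦ DerivedCategory.Q.obj R.complex, fun M hM hc ↦ ?_⟩
  let e := DerivedCategory.Q.objObjPreimageIso M
  obtain ⟨R, f, hf⟩ := exists_quasiIso_relations (DerivedCategory.Q.objPreimage M)
    fun n ↦ hc.isNoetherian_homology e.symm hM n
  exact ⟨R, ⟨e.symm ≪≫ (asIso (DerivedCategory.Q.map f)).symm⟩⟩
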